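/- For every integer n ≥ 4, the (n−1)×(n−1) matrix σ_{1,n}σ_{2,n}⋯σ_{n−2,n} has the block form: its top-left (n−2)×(n−2) block (rows and columns 1,…,n−2) equals the (n−2)×(n−2) matrix σ_{1,n−1}σ_{2,n−1}⋯σ_{n−2,n−1}; its last column (column n−1) has every entry equal to 1; and its last row (row n−1) is (0, …, 0, 1). -/

import Mathlib

/-- The reduced Burau matrix `σ_{i,n} ∈ Mat_{n-1}(ℤ)` of the braid generator `σ_i ∈ B_n`
evaluated at `t = -1`, for `1 ≤ i ≤ n-1` (the index `i` is 1-based, rows/columns of the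
matrix are 0-based): it agrees with the identity matrix except in row `i` (1-based), where
the entry in column `i-1` is `-1` (when `i ≥ 2`), the entry in column `i` is `1`, and the
entry in column `i+1` is `1` (when `i ≤ n-2`). -/
def burauSigma (n i : ℕ) : Matrix (Fin (n - 1)) (Fin (n - 1)) ℤ :=
  Matrix.of fun a b =>
    if a.val + 1 = i then
      if b.val + 2 = i then -1 else if b.val + 1 = i then 1 else if b.val = i then 1 else 0
    else if a = b then 1 else 0

/-- `D_n = σ_{1,n} σ_{2,n} ⋯ σ_{n-1,n}`, the reduced Burau matrix at `t = -1` of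
`δ = σ_1 σ_2 ⋯ σ_{n-1} ∈ B_n`. -/
def burauD (n : ℕ) : Matrix (Fin (n - 1)) (Fin (n - 1)) ℤ :=
  ((List.range (n - 1)).map fun i => burauSigma n (i + 1)).prod

/-- `E_n = σ_{n-1,n} σ_{n-2,n} ⋯ σ_{1,n}`, the reduced Burau matrix at `t = -1` of
`δ^Δ = σ_{n-1} σ_{n-2} ⋯ σ_1 ∈ B_n`. -/
def burauE (n : ℕ) : Matrix (Fin (n - 1)) (Fin (n - 1)) ℤ :=
  ((List.range (n - 1)).reverse.map fun i => burauSigma n (i + 1)).prod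

theorem burauSigma_succ_apply (n k : ℕ) (hk : k < n - 1) (a b : Fin (n - 1)) :
    burauSigma n (k + 1) a b = (if a = b then 1 else 0) +
      (if a = ⟨k, hk⟩ then
        (if b.val + 1 = k then -1 else if b.val = k + 1 then 1 else 0) else 0) := by
  simp only [burauSigma, Matrix.of_apply, Fin.ext_iff]
  split_ifs <;> grind

theorem burauSigma_partial_prod_apply (n k : ℕ) (hk : k ≤ n - 1) (a b : Fin (n - 1)) :
    ((List.range k).map fun i => burauSigma n (i + 1)).prod a b =
      if a.val < k then
        if b.val + 1 = k ∨ b.val = k then 1 else if b.val + 1 = a.val then -1 else 0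
      else if a = b then 1 else 0 := by
  induction k generalizing b with
  | zero => simp [Matrix.one_apply]
  | succ k ih =>
    have hk' : k < n - 1 := hk
    rw [List.range_succ, List.map_append, List.prod_append, List.map_singleton,
      List.prod_singleton, Matrix.mul_apply]
    simp only [burauSigma_succ_apply n k hk', mul_add, Finset.sum_add_distrib, mul_ite, mul_one,
      mul_zero, Finset.sum_ite_eq', Finset.mem_univ, if_true]
    rw [ih hk'.le, ih hk'.le]
    simp only [Fin.ext_iff]
    split_ifs <;> grind

/-- For every integer `n ≥ 4`, the `(n-1)×(n-1)` matrix `σ_{1,n} σ_{2,n} ⋯ σ_{n-2,n}` has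
the block form: its top-left `(n-2)×(n-2)` block equals the `(n-2)×(n-2)` matrix
`σ_{1,n-1} σ_{2,n-1} ⋯ σ_{n-2,n-1}`, its last column has every entry equal to `1`, and its
last row is `(0, …, 0, 1)`. -/
theorem burau_partial_prod_block (n : ℕ) (hn : 4 ≤ n) :
    (∀ (a b : Fin (n - 1)) (ha : a.val < n - 2) (hb : b.val < n - 2),
        ((List.range (n - 2)).map fun i => burauSigma n (i + 1)).prod a b =
          ((List.range (n - 2)).map fun i => burauSigma (n - 1) (i + 1)).prod
            ⟨a.val, by omega⟩ ⟨b.val, by omega⟩) ∧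
    (∀ a : Fin (n - 1),
        ((List.range (n - 2)).map fun i => burauSigma n (i + 1)).prod a ⟨n - 2, by omega⟩ = 1) ∧
    (∀ b : Fin (n - 1),
        ((List.range (n - 2)).map fun i => burauSigma n (i + 1)).prod ⟨n - 2, by omega⟩ b =
          if b.val = n - 2 then 1 else 0) := by
  refine ⟨fun a b ha hb => ?_, fun a => ?_, fun b => ?_⟩
  · rw [burauSigma_partial_prod_apply n _ (by omega),
      burauSigma_partial_prod_apply (n - 1) _ (by omega)]
    simp only [Fin.ext_iff]
  · rw [burauSigma_partial_prod_apply n _ (by omega)]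
    simp only [Fin.ext_iff]
    split_ifs <;> grind
  · rw [burauSigma_partial_prod_apply n _ (by omega)]
    simp only [Fin.ext_iff]
    split_ifs <;> grind
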